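/- Let K be a field, V a finite-dimensional K-vector space, and r ≥ 1 a natural number. Let c be an r-cycle in the permutation group of Fin r, and let P_c be the linear automorphism of the r-fold tensor power ⨂_{i : Fin r} V given by permuting the tensor factors according to c. Then the trace of P_c equals dim_K V. (This is the localization property tr(F^{⊠r}; σ_r) = tr(F; id) over a point: the K-theoretic Adams operation Ψ^r acts trivially on the Grothendieck group of finite-dimensional vector spaces.) -/

import Mathlib

open scoped TensorProduct

/-- If `c` is an `r`-cycle (`r ≥ 1`) in the symmetric group on `Fin r`, then the trace
of the linear automorphism of the `r`-fold tensor power `⨂_{i : Fin r} V` permuting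
the tensor factors according to `c` equals `dim_K V`: the `K`-theoretic Adams
operation `Ψʳ` acts trivially on the Grothendieck group of finite dimensional vector
spaces. -/
theorem trace_cycle_permutation_tensorPower (K : Type*) [Field K]
    (V : Type*) [AddCommGroup V] [Module K V] [FiniteDimensional K V]
    (r : ℕ) (hr : 1 ≤ r) (c : Equiv.Perm (Fin r))
    (hc : c.IsCycle) (hsupp : c.support = Finset.univ) :
    LinearMap.trace K _
        (PiTensorProduct.reindex K (fun _ : Fin r => V) c).toLinearMap =
      (Module.finrank K V : K) := by
  classical
  let b := Module.finBasis K V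
  let B := Basis.piTensorProduct (fun _ : Fin r => b)
  have hconst : ∀ p : Fin r → Fin (Module.finrank K V),
      (∀ i, p (c.symm i) = p i) → ∀ i j, p i = p j := by
    intro p hp i j
    have hmem : ∀ k, c k ≠ k := fun k => by
      rw [← Equiv.Perm.mem_support, hsupp]; exact Finset.mem_univ k
    obtain ⟨n, rfl⟩ := hc.exists_pow_eq (hmem i) (hmem j)
    have hstep : ∀ k, p (c k) = p k := fun k => by
      have := hp (c k)
      rw [Equiv.symm_apply_apply] at this
      exact this.symm
    induction n with
    | zero => simp
    | succ n ih => rw [pow_succ', Equiv.Perm.mul_apply, hstep]; exact ih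
  have hdiag : ∀ p : Fin r → Fin (Module.finrank K V),
      LinearMap.toMatrix B B (PiTensorProduct.reindex K (fun _ : Fin r => V) c).toLinearMap p p
        = if (∀ i, p (c.symm i) = p i) then 1 else 0 := by
    intro p
    rw [LinearMap.toMatrix_apply]
    have h1 : (PiTensorProduct.reindex K (fun _ : Fin r => V) c).toLinearMap (B p)
        = PiTensorProduct.tprod K (fun i => b (p (c.symm i))) := by
      simp only [B, Basis.piTensorProduct_apply]
      exact PiTensorProduct.reindex_tprod c _
    rw [h1]
    refine (Basis.piTensorProduct_repr_tprod_apply (fun _ : Fin r => b) _ p).trans ?_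
    simp [Finsupp.single_apply, Fintype.prod_ite_zero]
  rw [LinearMap.trace_eq_matrix_trace K B, Matrix.trace]
  simp only [Matrix.diag_apply, hdiag]
  rw [Finset.sum_boole]
  congr 1
  let i0 : Fin r := ⟨0, hr⟩
  conv_rhs => rw [← Fintype.card_fin (Module.finrank K V), ← Finset.card_univ]
  refine Finset.card_bij' (fun p _ => p i0) (fun a _ => fun _ => a) ?_ ?_ ?_ ?_
  · simp
  · simp
  · intro p hp
    funext i
    exact hconst p (Finset.mem_filter.mp hp).2 _ _
  · simp
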